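/- Let D be a nonempty open connected subset of ℝ² whose complement in the one-point compactification S² = ℝ² ∪ {∞}, namely (ℝ² \ D) ∪ {∞}, is connected. Then D is simply connected. -/

import Mathlib

namespace SC17

open Set Topology

/-- lattice point as a point of the plane -/
noncomputable def pt (u : ℤ × ℤ) : ℝ × ℝ := ((u.1 : ℝ), (u.2 : ℝ))

/-- bounding box of two lattice points -/
def box (u v : ℤ × ℤ) : Set (ℝ × ℝ) :=
  uIcc (u.1 : ℝ) (v.1 : ℝ) ×ˢ uIcc (u.2 : ℝ) (v.2 : ℝ)

def cell (i j : ℤ) : Set (ℝ × ℝ) := box (i, j) (i + 1, j + 1)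

lemma mem_cell {i j : ℤ} {p : ℝ × ℝ} :
    p ∈ cell i j ↔ ((i : ℝ) ≤ p.1 ∧ p.1 ≤ i + 1) ∧ ((j : ℝ) ≤ p.2 ∧ p.2 ≤ j + 1) := by
  simp only [cell, box, Set.mem_prod]
  push_cast
  rw [uIcc_of_le (by linarith), uIcc_of_le (by linarith), mem_Icc, mem_Icc]

lemma convex_box (u v : ℤ × ℤ) : Convex ℝ (box u v) :=
  (convex_uIcc _ _).prod (convex_uIcc _ _)

lemma box_swap (u v : ℤ × ℤ) : box u v = box v u := by
  simp [box, uIcc_comm]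

lemma pt_mem_box_left (u v : ℤ × ℤ) : pt u ∈ box u v := ⟨left_mem_uIcc, left_mem_uIcc⟩
lemma pt_mem_box_right (u v : ℤ × ℤ) : pt v ∈ box u v := ⟨right_mem_uIcc, right_mem_uIcc⟩

/-- lattice steps (possibly trivial) -/
def Adj (u v : ℤ × ℤ) : Prop := |u.1 - v.1| + |u.2 - v.2| ≤ 1

def R (D : Set (ℝ × ℝ)) (u v : ℤ × ℤ) : Prop := Adj u v ∧ box u v ⊆ D

lemma Adj.cases {u v : ℤ × ℤ} (h : Adj u v) :
    (v.1 = u.1 ∧ v.2 = u.2) ∨ (v.1 = u.1 + 1 ∧ v.2 = u.2) ∨ (v.1 = u.1 - 1 ∧ v.2 = u.2) ∨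
    (v.1 = u.1 ∧ v.2 = u.2 + 1) ∨ (v.1 = u.1 ∧ v.2 = u.2 - 1) := by
  unfold Adj at h
  grind

/-- sum of a step function along a walk -/
def S {A : Type*} [AddCommGroup A] (f : ℤ × ℤ → ℤ × ℤ → A) : ℤ × ℤ → List (ℤ × ℤ) → A
  | _, [] => 0
  | a, b :: l => f a b + S f b l

lemma S_tele (f : ℤ × ℤ → ℤ) (a : ℤ × ℤ) (l : List (ℤ × ℤ)) (b : ℤ × ℤ) :
    S (fun u v => f v - f u) a (l ++ [b]) = f b - f a := by
  induction l generalizing a with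
  | nil => simp [S]
  | cons c l ih => simp [S, ih]

lemma S_congr {r : ℤ × ℤ → ℤ × ℤ → Prop} {f g : ℤ × ℤ → ℤ × ℤ → ℤ}
    (h : ∀ u v, r u v → f u v = g u v) (a : ℤ × ℤ) (l : List (ℤ × ℤ))
    (hc : List.IsChain r (a :: l)) : S f a l = S g a l := by
  induction l generalizing a with
  | nil => simp [S]
  | cons c l ih =>
    rw [List.isChain_cons_cons] at hc
    simp [S, ih _ hc.2, h _ _ hc.1]

lemma S_add (f g : ℤ × ℤ → ℤ × ℤ → ℤ) (a : ℤ × ℤ) (l : List (ℤ × ℤ)) :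
    S (fun u v => f u v + g u v) a l = S f a l + S g a l := by
  induction l generalizing a with
  | nil => simp [S]
  | cons c l ih => simp only [S, ih]; ring

lemma S_append (f : ℤ × ℤ → ℤ × ℤ → ℤ) (a : ℤ × ℤ) (l : List (ℤ × ℤ)) (b : ℤ × ℤ)
    (m : List (ℤ × ℤ)) : S f a (l ++ b :: m) = S f a (l ++ [b]) + S f b m := by
  induction l generalizing a with
  | nil => simp [S]
  | cons c l ih => simp only [List.cons_append, S, ih]; ring

lemma S_zero {f : ℤ × ℤ → ℤ × ℤ → ℤ} (a : ℤ × ℤ) (l : List (ℤ × ℤ))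
    (h : ∀ u ∈ a :: l, ∀ v ∈ a :: l, f u v = 0) : S f a l = 0 := by
  induction l generalizing a with
  | nil => simp [S]
  | cons c l ih =>
    simp only [S]
    rw [h a (by simp) c (by simp), ih c (fun u hu v hv => h u (by simp [hu]) v (by simp [hv]))]
    simp

/-- signed crossings of the upward ray from the cell `(i,j)`. -/
def H (i j : ℤ) (u v : ℤ × ℤ) : ℤ :=
  if u.2 = v.2 ∧ j < u.2 ∧ u.1 = i ∧ v.1 = i + 1 then 1
  else if u.2 = v.2 ∧ j < u.2 ∧ v.1 = i ∧ u.1 = i + 1 then -1 else 0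

lemma W_hor {D : Set (ℝ × ℝ)} {a : ℤ × ℤ} {l : List (ℤ × ℤ)}
    (hc : List.IsChain (R D) (a :: (l ++ [a]))) {i j : ℤ} {p : ℝ × ℝ} (hp : p ∉ D)
    (h1 : p.1 = i) (h2 : (j : ℝ) ≤ p.2) (h3 : p.2 ≤ j + 1) :
    S (H i j) a (l ++ [a]) = S (H (i - 1) j) a (l ++ [a]) := by
  have key := S_tele (fun u => if u.1 = i ∧ j < u.2 then 1 else 0) a l a
  have : S (H (i - 1) j) a (l ++ [a]) = S (fun u v => H i j u v +
    ((if v.1 = i ∧ j < v.2 then 1 else 0) - (if u.1 = i ∧ j < u.2 then 1 else 0))) a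
      (l ++ [a]) := by
    refine S_congr (r := R D) ?_ _ _ hc
    rintro ⟨u1, u2⟩ ⟨v1, v2⟩ ⟨hA, hD⟩
    have hn1 : ¬ (u1 = i ∧ v1 = i ∧ u2 = j ∧ v2 = j + 1) := by
      rintro ⟨rfl, rfl, rfl, rfl⟩
      apply hp; apply hD
      simp [box, Set.mem_prod, uIcc_of_le, h1, h2, h3]
    have hn2 : ¬ (u1 = i ∧ v1 = i ∧ v2 = j ∧ u2 = j + 1) := by
      rintro ⟨rfl, rfl, rfl, rfl⟩
      apply hp; apply hD; rw [box_swap]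
      simp [box, Set.mem_prod, uIcc_of_le, h1, h2, h3]
    have := hA.cases
    simp only [H] at *
    split_ifs <;> omega
  rw [this, S_add, key]; simp

lemma W_ver {D : Set (ℝ × ℝ)} {a : ℤ × ℤ} {l : List (ℤ × ℤ)}
    (hc : List.IsChain (R D) (a :: (l ++ [a]))) {i j : ℤ} {p : ℝ × ℝ} (hp : p ∉ D)
    (h1 : p.2 = j) (h2 : (i : ℝ) ≤ p.1) (h3 : p.1 ≤ i + 1) :
    S (H i j) a (l ++ [a]) = S (H i (j - 1)) a (l ++ [a]) := by
  refine S_congr (r := R D) ?_ _ _ hc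
  rintro ⟨u1, u2⟩ ⟨v1, v2⟩ ⟨hA, hD⟩
  have hn1 : ¬ (u1 = i ∧ v1 = i + 1 ∧ u2 = j ∧ v2 = j) := by
    rintro ⟨rfl, rfl, rfl, rfl⟩
    apply hp; apply hD
    simp [box, Set.mem_prod, uIcc_of_le, h1, h2, h3]
  have hn2 : ¬ (v1 = i ∧ u1 = i + 1 ∧ v2 = j ∧ u2 = j) := by
    rintro ⟨rfl, rfl, rfl, rfl⟩
    apply hp; apply hD; rw [box_swap]
    simp [box, Set.mem_prod, uIcc_of_le, h1, h2, h3]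
  simp only [H] at *
  split_ifs <;> omega

lemma W_same {D : Set (ℝ × ℝ)} {a : ℤ × ℤ} {l : List (ℤ × ℤ)}
    (hc : List.IsChain (R D) (a :: (l ++ [a]))) {i j k m : ℤ} {p : ℝ × ℝ} (hp : p ∉ D)
    (h1 : p ∈ cell i j) (h2 : p ∈ cell k m) :
    S (H i j) a (l ++ [a]) = S (H k m) a (l ++ [a]) := by
  rw [mem_cell] at h1 h2
  have e1 : S (H i j) a (l ++ [a]) = S (H k j) a (l ++ [a]) := by
    have c1 : i ≤ k + 1 := by exact_mod_cast (h1.1.1.trans h2.1.2)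
    have c2 : k ≤ i + 1 := by exact_mod_cast (h2.1.1.trans h1.1.2)
    obtain h | h | h : i = k ∨ i = k + 1 ∨ k = i + 1 := by omega
    · rw [h]
    · subst h
      rw [W_hor hc hp _ h1.2.1 h1.2.2, add_sub_cancel_right]
      exact le_antisymm (by push_cast; exact h2.1.2) h1.1.1
    · subst h
      rw [W_hor (i := i + 1) hc hp _ h1.2.1 h1.2.2, add_sub_cancel_right]
      exact le_antisymm (by push_cast; exact h1.1.2) h2.1.1
  rw [e1]
  have c1 : j ≤ m + 1 := by exact_mod_cast (h1.2.1.trans h2.2.2)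
  have c2 : m ≤ j + 1 := by exact_mod_cast (h2.2.1.trans h1.2.2)
  obtain h | h | h : j = m ∨ j = m + 1 ∨ m = j + 1 := by omega
  · rw [h]
  · subst h
    rw [W_ver hc hp _ h2.1.1 h2.1.2, add_sub_cancel_right]
    exact le_antisymm (by push_cast; exact h2.2.2) h1.2.1
  · subst h
    rw [W_ver (j := j + 1) hc hp _ h2.1.1 h2.1.2, add_sub_cancel_right]
    exact le_antisymm (by push_cast; exact h1.2.2) h2.2.1

/-- boundedness of the set of cells with nonzero index -/
lemma W_bdd {D : Set (ℝ × ℝ)} {a : ℤ × ℤ} {l : List (ℤ × ℤ)}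
    (hc : List.IsChain (R D) (a :: (l ++ [a]))) :
    ∃ N : ℤ, ∀ i j, S (H i j) a (l ++ [a]) ≠ 0 → (-N ≤ i ∧ i ≤ N) ∧ (-N ≤ j ∧ j ≤ N) := by
  obtain ⟨N, hN⟩ : ∃ N : ℤ, ∀ u ∈ a :: (l ++ [a]), |u.1| < N ∧ |u.2| < N := by
    generalize a :: (l ++ [a]) = L
    induction L with
    | nil => simp
    | cons b L ih =>
      obtain ⟨N, hN⟩ := ih
      refine ⟨max N (max (|b.1| + 1) (|b.2| + 1)), ?_⟩
      intro u hu
      rcases List.mem_cons.1 hu with rfl | hu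
      · constructor <;> simp
      · have := hN u hu
        exact ⟨lt_max_of_lt_left this.1, lt_max_of_lt_left this.2⟩
  refine ⟨N, fun i j => ?_⟩
  contrapose!
  intro h
  by_cases hj : j < -N
  · -- below everything
    have key := S_tele (fun u => if i + 1 ≤ u.1 then 1 else 0) a l a
    rw [sub_self] at key
    rw [← key]
    refine S_congr (r := fun u v => Adj u v ∧ j < u.2) ?_ _ _ ?_
    · rintro ⟨u1, u2⟩ ⟨v1, v2⟩ ⟨hA, hD⟩
      have := hA.cases
      simp only [H] at *
      split_ifs <;> omega
    · rw [List.isChain_iff_getElem] at hc ⊢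
      intro k hk
      refine ⟨(hc k hk).1, ?_⟩
      have := hN _ (List.getElem_mem (by omega : k < (a :: (l ++ [a])).length))
      have := (abs_lt.1 this.2).1
      omega
  · apply S_zero
    intro u hu v hv
    have h1 := hN u hu
    have h2 := hN v hv
    rw [abs_lt, abs_lt] at h1 h2
    simp only [H]
    by_cases hi : -N ≤ i ∧ i ≤ N
    · have := h hi (by omega)
      split_ifs <;> omega
    · split_ifs <;> omega

/-- the topological separation property -/
def Sep (D : Set (ℝ × ℝ)) : Prop := ∀ Z : Set (ℝ × ℝ), IsCompact Z → Z \ D ⊆ interior Z → Z ⊆ D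

lemma cell_subset {D : Set (ℝ × ℝ)} (hS : Sep D) {a : ℤ × ℤ} {l : List (ℤ × ℤ)}
    (hc : List.IsChain (R D) (a :: (l ++ [a]))) {i j : ℤ}
    (h : S (H i j) a (l ++ [a]) ≠ 0) : cell i j ⊆ D := by
  obtain ⟨N, hN⟩ := W_bdd hc
  set T : Set (ℤ × ℤ) := {q | S (H q.1 q.2) a (l ++ [a]) ≠ 0} with hT
  have hTf : T.Finite := by
    refine (Set.finite_Icc ((-N, -N) : ℤ × ℤ) (N, N)).subset ?_
    rintro ⟨i, j⟩ hij
    have := hN i j hij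
    exact ⟨⟨this.1.1, this.2.1⟩, ⟨this.1.2, this.2.2⟩⟩
  have hZ := hS (⋃ q ∈ T, cell q.1 q.2) ?_ ?_
  · refine Subset.trans ?_ hZ
    exact Set.subset_biUnion_of_mem (u := fun q : ℤ × ℤ => cell q.1 q.2) (show (i, j) ∈ T from h)
  · exact hTf.isCompact_biUnion fun q _ => isCompact_uIcc.prod isCompact_uIcc
  · rintro p ⟨hp, hpD⟩
    simp only [mem_iUnion] at hp
    obtain ⟨q, hq, hpq⟩ := hp
    rw [mem_interior_iff_mem_nhds]
    have f1 : ∀ᶠ x : ℝ in 𝓝 p.1, x < ⌊p.1⌋ + 1 ∧ (⌈p.1⌉ : ℝ) - 1 < x :=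
      (eventually_lt_nhds (Int.lt_floor_add_one _)).and
        (eventually_gt_nhds (by linarith [Int.ceil_lt_add_one p.1]))
    have f2 : ∀ᶠ x : ℝ in 𝓝 p.2, x < ⌊p.2⌋ + 1 ∧ (⌈p.2⌉ : ℝ) - 1 < x :=
      (eventually_lt_nhds (Int.lt_floor_add_one _)).and
        (eventually_gt_nhds (by linarith [Int.ceil_lt_add_one p.2]))
    have aux : ∀ x y : ℝ, (x < ⌊y⌋ + 1 ∧ (⌈y⌉ : ℝ) - 1 < x) →
        ((⌊x⌋ : ℝ) ≤ y ∧ y ≤ ⌊x⌋ + 1) := by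
      rintro x y ⟨h1, h2⟩
      have h3 : ⌊x⌋ < ⌊y⌋ + 1 := Int.floor_lt.2 (by push_cast; exact h1)
      have h4 : ⌈y⌉ - 1 ≤ ⌊x⌋ := Int.le_floor.2 (by push_cast; exact h2.le)
      constructor
      · have : (⌊x⌋ : ℝ) ≤ ⌊y⌋ := by exact_mod_cast (by omega : ⌊x⌋ ≤ ⌊y⌋)
        exact this.trans (Int.floor_le _)
      · have : (⌈y⌉ : ℝ) ≤ ⌊x⌋ + 1 := by exact_mod_cast (by omega : ⌈y⌉ ≤ ⌊x⌋ + 1)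
        exact (Int.le_ceil _).trans this
    have f := (continuous_fst.tendsto p).eventually f1 |>.and
      ((continuous_snd.tendsto p).eventually f2)
    filter_upwards [f] with x hx
    have hpc : p ∈ cell ⌊x.1⌋ ⌊x.2⌋ := mem_cell.2 ⟨aux _ _ hx.1, aux _ _ hx.2⟩
    have hxc : x ∈ cell ⌊x.1⌋ ⌊x.2⌋ := mem_cell.2
      ⟨⟨Int.floor_le _, (Int.lt_floor_add_one _).le⟩, ⟨Int.floor_le _, (Int.lt_floor_add_one _).le⟩⟩
    have := W_same hc hpD hpq hpc
    refine mem_biUnion (x := (⌊x.1⌋, ⌊x.2⌋)) ?_ hxc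
    simp only [hT, mem_ofPred_eq]
    rw [← this]; exact hq

/-! ### products along walks -/

section Group
variable {G : Type*} [Group G]

def P (e : ℤ × ℤ → ℤ × ℤ → G) : ℤ × ℤ → List (ℤ × ℤ) → G
  | _, [] => 1
  | a, b :: l => e a b * P e b l

lemma P_append (e : ℤ × ℤ → ℤ × ℤ → G) (a : ℤ × ℤ) (l : List (ℤ × ℤ)) (b : ℤ × ℤ)
    (m : List (ℤ × ℤ)) : P e a (l ++ b :: m) = P e a (l ++ [b]) * P e b m := by
  induction l generalizing a with
  | nil => simp [P]
  | cons c l ih => simp only [List.cons_append, P, ih, mul_assoc]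

lemma rot {D : Set (ℝ × ℝ)} (e : ℤ × ℤ → ℤ × ℤ → G) {a u : ℤ × ℤ} {l L L' : List (ℤ × ℤ)}
    (h : a :: l = L ++ u :: L') (hc : List.IsChain (R D) (a :: (l ++ [a]))) :
    List.IsChain (R D) (u :: (L' ++ L ++ [u])) ∧
      (P e u (L' ++ L ++ [u]) = 1 → P e a (l ++ [a]) = 1) := by
  cases L with
  | nil =>
    simp only [List.nil_append, List.cons.injEq] at h
    obtain ⟨rfl, rfl⟩ := h
    simpa using hc
  | cons b L =>
    simp only [List.cons_append, List.cons.injEq] at h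
    obtain ⟨rfl, rfl⟩ := h
    have h1 : a :: (L ++ u :: L' ++ [a]) = (a :: L) ++ u :: (L' ++ [a]) := by simp
    have h2 : u :: (L' ++ a :: L ++ [u]) = (u :: L') ++ a :: (L ++ [u]) := by simp
    rw [h1, List.isChain_split] at hc
    rw [h2, List.isChain_split]
    refine ⟨⟨by simpa using hc.2, by simpa using hc.1⟩, ?_⟩
    have h3 : L ++ u :: L' ++ [a] = L ++ u :: (L' ++ [a]) := by simp
    have h4 : L' ++ a :: L ++ [u] = L' ++ a :: (L ++ [u]) := by simp
    rw [h3, h4, P_append e u, P_append e a L u (L' ++ [a])]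
    intro hh
    rw [mul_eq_one_iff_eq_inv] at hh ⊢
    rw [hh, inv_inv]

lemma exists_dup {L : List (ℤ × ℤ)} (h : ¬ L.Nodup) :
    ∃ l1 u l2 l3, L = l1 ++ u :: (l2 ++ u :: l3) := by
  induction L with
  | nil => simp at h
  | cons a L ih =>
    by_cases ha : a ∈ L
    · obtain ⟨s, t, rfl⟩ := List.append_of_mem ha
      exact ⟨[], a, s, t, rfl⟩
    · obtain ⟨l1, u, l2, l3, rfl⟩ := ih (fun h' => h (List.nodup_cons.2 ⟨ha, h'⟩))
      exact ⟨a :: l1, u, l2, l3, rfl⟩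

lemma exists_top (a : ℤ × ℤ) (l : List (ℤ × ℤ)) :
    ∃ v ∈ a :: l, ∀ u ∈ a :: l, u.2 < v.2 ∨ (u.2 = v.2 ∧ u.1 ≤ v.1) := by
  induction l generalizing a with
  | nil => exact ⟨a, by simp, by simp⟩
  | cons b l ih =>
    obtain ⟨v, hv, h⟩ := ih b
    by_cases hh : a.2 < v.2 ∨ (a.2 = v.2 ∧ a.1 ≤ v.1)
    · refine ⟨v, List.mem_cons_of_mem _ hv, ?_⟩
      intro u hu
      rcases List.mem_cons.1 hu with rfl | hu
      · exact hh
      · exact h u hu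
    · refine ⟨a, by simp, ?_⟩
      intro u hu
      rcases List.mem_cons.1 hu with rfl | hu
      · right; simp
      · have := h u hu
        omega

def meas (M : ℤ) (L : List (ℤ × ℤ)) : ℕ := (L.map fun u => (u.1 + u.2 - 2 * M).toNat).sum

lemma meas_perm (M : ℤ) {L L' : List (ℤ × ℤ)} (h : L.Perm L') : meas M L = meas M L' :=
  (h.map _).sum_eq

theorem core {D : Set (ℝ × ℝ)} (hS : Sep D) (g : ℝ × ℝ → ℝ × ℝ → G)
    (hT : ∀ C : Set (ℝ × ℝ), Convex ℝ C → C ⊆ D → ∀ x ∈ C, ∀ y ∈ C, ∀ z ∈ C,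
      g x y * g y z = g x z) (M : ℤ) :
    ∀ n s : ℕ, ∀ (a : ℤ × ℤ) (l : List (ℤ × ℤ)), l.length = n → meas M (a :: l) = s →
      (∀ u ∈ a :: l, M ≤ u.1 ∧ M ≤ u.2) → List.IsChain (R D) (a :: (l ++ [a])) →
      P (fun u v => g (pt u) (pt v)) a (l ++ [a]) = 1 := by
  set e : ℤ × ℤ → ℤ × ℤ → G := fun u v => g (pt u) (pt v) with he
  have hself : ∀ u v, box u v ⊆ D → ∀ w, pt w ∈ box u v → e w w = 1 := by
    intro u v h w hw
    have := hT _ (convex_box u v) h _ hw _ hw _ hw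
    simpa using this
  intro n
  induction n using Nat.strong_induction_on with
  | _ n ihn =>
  intro s
  induction s using Nat.strong_induction_on with
  | _ s ihs =>
  intro a l hl hs hM hc
  by_cases hnd : (a :: l).Nodup
  swap
  · obtain ⟨l1, u, l2, l3, hdup⟩ := exists_dup hnd
    obtain ⟨hc', hP⟩ := rot e hdup hc
    apply hP
    have h3 : l2 ++ u :: l3 ++ l1 ++ [u] = l2 ++ u :: (l3 ++ l1 ++ [u]) := by simp
    have h4 : u :: (l2 ++ u :: l3 ++ l1 ++ [u]) = (u :: l2) ++ u :: (l3 ++ l1 ++ [u]) := by simp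
    rw [h4, List.isChain_split] at hc'
    have hlen := congrArg List.length hdup
    simp at hlen
    rw [h3, P_append]
    have q1 := ihn l2.length (by omega) _ u l2 rfl rfl
      (fun w hw => hM w (by rw [hdup]; simp at hw ⊢; tauto)) (by simpa using hc'.1)
    have q2 := ihn (l3 ++ l1).length (by simp; omega) _ u (l3 ++ l1) rfl rfl
      (fun w hw => hM w (by rw [hdup]; simp at hw ⊢; tauto)) (by simpa using hc'.2)
    rw [q1, q2, one_mul]
  -- simple walk
  obtain ⟨v, hv, hmax⟩ := exists_top a l
  obtain ⟨L, L', hdec⟩ := List.append_of_mem hv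
  obtain ⟨hc', hP⟩ := rot e hdec hc
  apply hP
  clear hP
  have hperm : (a :: l).Perm (v :: (L' ++ L)) := by
    rw [hdec]
    exact List.perm_append_comm
  have hlen : (L' ++ L).length = n := by
    have := hperm.length_eq
    simp only [List.length_cons] at this
    omega
  rw [meas_perm M hperm] at hs
  replace hM : ∀ u ∈ v :: (L' ++ L), M ≤ u.1 ∧ M ≤ u.2 := fun u hu => hM u (hperm.mem_iff.2 hu)
  replace hmax : ∀ u ∈ v :: (L' ++ L), u.2 < v.2 ∨ (u.2 = v.2 ∧ u.1 ≤ v.1) :=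
    fun u hu => hmax u (hperm.mem_iff.2 hu)
  rw [hperm.nodup_iff] at hnd
  generalize L' ++ L = K at *
  clear hc hperm hdec
  rcases K with _ | ⟨b, K⟩
  · have := hc'
    simp [R] at this
    simp [P]
    exact hself v v this.2 v (pt_mem_box_left _ _)
  rcases List.eq_nil_or_concat K with rfl | ⟨K, c, rfl⟩
  · simp [R] at hc'
    have hb := hc'.1.2
    simp only [P, List.cons_append, List.nil_append, mul_one]
    rw [show e v b * e b v = e v v from hT _ (convex_box v b) hb _ (pt_mem_box_left _ _) _
      (pt_mem_box_right _ _) _ (pt_mem_box_left _ _)]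
    exact hself v b hb v (pt_mem_box_left _ _)
  rw [List.concat_eq_append] at *
  have hb : R D v b := by
    simp only [List.cons_append, List.isChain_cons_cons] at hc'; exact hc'.1
  have hcv : R D c v := by
    have h4 : v :: (b :: (K ++ [c]) ++ [v]) = (v :: b :: K) ++ c :: [v] := by simp
    rw [h4, List.isChain_split] at hc'
    simpa using hc'.2
  have hmid : List.IsChain (R D) (b :: (K ++ [c])) := by
    have h4 : v :: (b :: (K ++ [c]) ++ [v]) = (v :: b :: K) ++ c :: [v] := by simp
    rw [h4, List.isChain_split] at hc'
    have := hc'.1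
    simp only [List.cons_append, List.isChain_cons_cons] at this
    exact this.2
  have hbm := hmax b (by simp)
  have hcm := hmax c (by simp)
  have hvb : v ≠ b := by rintro rfl; simp at hnd
  have hvc : v ≠ c := by rintro rfl; simp at hnd
  have hbc : b ≠ c := by rintro rfl; simp at hnd
  have hvb' : ¬ (v.1 = b.1 ∧ v.2 = b.2) := fun h => hvb (Prod.ext h.1 h.2)
  have hvc' : ¬ (v.1 = c.1 ∧ v.2 = c.2) := fun h => hvc (Prod.ext h.1 h.2)
  have hbc' : ¬ (b.1 = c.1 ∧ b.2 = c.2) := fun h => hbc (Prod.ext h.1 h.2)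
  have cb := hb.1.cases
  have cc := hcv.1.cases
  have hcase : (b.1 = v.1 - 1 ∧ b.2 = v.2 ∧ c.1 = v.1 ∧ c.2 = v.2 - 1) ∨
      (c.1 = v.1 - 1 ∧ c.2 = v.2 ∧ b.1 = v.1 ∧ b.2 = v.2 - 1) := by omega
  -- the index of the cell below-left of `v`
  have hW : S (H (v.1 - 1) (v.2 - 1)) v (b :: (K ++ [c]) ++ [v]) ≠ 0 := by
    have h4 : b :: (K ++ [c]) ++ [v] = b :: (K ++ c :: [v]) := by simp
    rw [h4]
    simp only [S]
    rw [S_append, S_zero b (K ++ [c])]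
    · simp only [S, H]
      split_ifs <;> omega
    · intro x hx y hy
      have hxv : x ≠ v := by rintro rfl; exact (List.nodup_cons.1 hnd).1 hx
      have hyv : y ≠ v := by rintro rfl; exact (List.nodup_cons.1 hnd).1 hy
      have hxv' : ¬ (x.1 = v.1 ∧ x.2 = v.2) := fun h => hxv (Prod.ext h.1 h.2)
      have hyv' : ¬ (y.1 = v.1 ∧ y.2 = v.2) := fun h => hyv (Prod.ext h.1 h.2)
      have hx1 := hmax x (List.mem_cons_of_mem _ hx)
      have hy1 := hmax y (List.mem_cons_of_mem _ hy)
      simp only [H]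
      split_ifs <;> omega
  have hcell := cell_subset hS hc' hW
  set v' : ℤ × ℤ := (v.1 - 1, v.2 - 1) with hv'
  have hptc : ∀ w : ℤ × ℤ, v.1 - 1 ≤ w.1 → w.1 ≤ v.1 → v.2 - 1 ≤ w.2 → w.2 ≤ v.2 →
      pt w ∈ cell (v.1 - 1) (v.2 - 1) := by
    intro w h1 h2 h3 h4
    rw [mem_cell]
    simp only [pt]
    refine ⟨⟨?_, ?_⟩, ⟨?_, ?_⟩⟩ <;> norm_cast <;> omega
  have hbox : ∀ w x : ℤ × ℤ, pt w ∈ cell (v.1 - 1) (v.2 - 1) → pt x ∈ cell (v.1 - 1) (v.2 - 1) →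
      box w x ⊆ D := by
    intro w x hw hx
    refine Subset.trans ?_ hcell
    rw [cell, box, Set.mem_prod] at hw hx
    exact Set.prod_mono (uIcc_subset_uIcc hw.1 hx.1) (uIcc_subset_uIcc hw.2 hx.2)
  have pv := hptc v (by omega) (by omega) (by omega) (by omega)
  have pv' := hptc v' (by simp [hv']) (by simp [hv']) (by simp [hv']) (by simp [hv'])
  have pb := hptc b (by omega) (by omega) (by omega) (by omega)
  have pc := hptc c (by omega) (by omega) (by omega) (by omega)
  have hTc := hT _ (convex_box _ _ : Convex ℝ (cell (v.1 - 1) (v.2 - 1))) hcell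
  have Rb : R D v' b := ⟨by simp only [Adj, hv']; grind, hbox _ _ pv' pb⟩
  have Rc : R D c v' := ⟨by simp only [Adj, hv']; grind, hbox _ _ pc pv'⟩
  have hvM := hM v (by simp)
  have hbM := hM b (by simp)
  have hcM := hM c (by simp)
  have hnew := ihs (meas M (v' :: (b :: (K ++ [c])))) (by
      rw [← hs]
      simp only [meas, List.map_cons, List.sum_cons, hv']
      omega) v' (b :: (K ++ [c])) hlen rfl (by
      intro u hu
      rcases List.mem_cons.1 hu with rfl | hu
      · simp only [hv']; omega
      · exact hM u (List.mem_cons_of_mem _ hu)) (by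
      have h4 : v' :: (b :: (K ++ [c]) ++ [v']) = (v' :: b :: K) ++ c :: [v'] := by simp
      rw [h4, List.isChain_split]
      refine ⟨?_, by simpa using Rc⟩
      simp only [List.cons_append, List.isChain_cons_cons]
      exact ⟨Rb, hmid⟩)
  have h4 : ∀ w, b :: (K ++ [c]) ++ [w] = b :: (K ++ c :: [w]) := by simp
  rw [h4] at hnew ⊢
  simp only [P] at hnew ⊢
  rw [P_append] at hnew ⊢
  simp only [P, mul_one] at hnew ⊢
  have t1 : e v v' * e v' b = e v b := hTc _ pv _ pv' _ pb
  have t2 : e c v' * e v' v = e c v := hTc _ pc _ pv' _ pv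
  have t3 : e v v' * e v' v = e v v := hTc _ pv _ pv' _ pv
  have t4 : e v v = 1 := hself v b hb.2 v (pt_mem_box_left _ _)
  rw [← t1, ← t2]
  calc e v v' * e v' b * (P e b (K ++ [c]) * (e c v' * e v' v))
      = e v v' * (e v' b * (P e b (K ++ [c]) * e c v')) * e v' v := by simp only [mul_assoc]
    _ = 1 := by rw [hnew, mul_one, t3, t4]

end Group


/-! ### the fundamental group side -/

lemma sep_of_compl {D : Set (ℝ × ℝ)}
    (hcompl : IsConnected (((fun x : ℝ × ℝ => (x : OnePoint (ℝ × ℝ))) '' D)ᶜ)) : Sep D := by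
  intro Z hZ hint z hz
  by_contra hzD
  have hinj : Function.Injective (fun x : ℝ × ℝ => (x : OnePoint (ℝ × ℝ))) :=
    OnePoint.coe_injective
  have hU : IsOpen ((fun x : ℝ × ℝ => (x : OnePoint (ℝ × ℝ))) '' interior Z) :=
    OnePoint.isOpenEmbedding_coe.isOpenMap _ isOpen_interior
  have hV : IsOpen (((fun x : ℝ × ℝ => (x : OnePoint (ℝ × ℝ))) '' Z)ᶜ) :=
    (hZ.image OnePoint.continuous_coe).isClosed.isOpen_compl
  obtain ⟨w, -, ⟨x, hx, rfl⟩, hw⟩ := hcompl.isPreconnected _ _ hU hV (by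
    intro w hw
    by_cases h : w ∈ (fun x : ℝ × ℝ => (x : OnePoint (ℝ × ℝ))) '' Z
    · left
      obtain ⟨x, hx, rfl⟩ := h
      exact ⟨x, hint ⟨hx, fun h => hw ⟨x, h, rfl⟩⟩, rfl⟩
    · exact Or.inr h)
    ⟨(z : OnePoint (ℝ × ℝ)), by
      rintro ⟨x, hx, h⟩
      rw [hinj h] at hx; exact hzD hx, z, hint ⟨hz, hzD⟩, rfl⟩
    ⟨OnePoint.infty, by simp, by simp⟩
  exact hw ⟨x, interior_subset hx, rfl⟩

lemma sep_smul {D : Set (ℝ × ℝ)} (h : Sep D) {δ : ℝ} (hδ : δ ≠ 0) : Sep {p | δ • p ∈ D} := by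
  open Pointwise in
  intro Z hZ hint z hz
  refine h (δ • Z) (hZ.smul δ) ?_ (smul_mem_smul_set hz)
  rintro _ ⟨⟨x, hx, rfl⟩, hxD⟩
  rw [interior_smul₀ hδ]
  exact smul_mem_smul_set (hint ⟨hx, hxD⟩)

section Pi1
variable {D : Set (ℝ × ℝ)}

lemma homot_convex {C : Set (ℝ × ℝ)} (hC : Convex ℝ C) (hCD : C ⊆ D) {x y : D} (p q : Path x y)
    (hp : ∀ t, (p t : ℝ × ℝ) ∈ C) (hq : ∀ t, (q t : ℝ × ℝ) ∈ C) : p.Homotopic q := by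
  have hx : (x : ℝ × ℝ) ∈ C := by simpa using hp 0
  have hy : (y : ℝ × ℝ) ∈ C := by simpa using hp 1
  haveI : ContractibleSpace C := hC.contractibleSpace ⟨_, hx⟩
  let p' : Path (⟨x, hx⟩ : C) ⟨y, hy⟩ :=
    { toFun := fun t => ⟨p t, hp t⟩, source' := by simp, target' := by simp }
  let q' : Path (⟨x, hx⟩ : C) ⟨y, hy⟩ :=
    { toFun := fun t => ⟨q t, hq t⟩, source' := by simp, target' := by simp }
  exact (SimplyConnectedSpace.paths_homotopic p' q').map
    ⟨Set.inclusion hCD, continuous_inclusion hCD⟩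

lemma exists_path_convex {C : Set (ℝ × ℝ)} (hC : Convex ℝ C) (hCD : C ⊆ D) (x y : D)
    (hx : (x : ℝ × ℝ) ∈ C) (hy : (y : ℝ × ℝ) ∈ C) :
    ∃ p : Path x y, ∀ t, (p t : ℝ × ℝ) ∈ C := by
  obtain ⟨p, hp⟩ := (hC.isPathConnected ⟨_, hx⟩).joinedIn _ hx _ hy
  exact ⟨{ toFun := fun t => ⟨p t, hCD (hp t)⟩, source' := by simp, target' := by simp },
    fun t => hp t⟩

variable {b : D} (c : ∀ x : D, Path b x)

/-- the element of the fundamental group attached to a class of paths -/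
noncomputable def Mo {x y : D} (q : Path.Homotopic.Quotient x y) : (FundamentalGroup D b)ᵐᵒᵖ :=
  MulOpposite.op (FundamentalGroup.fromPath
    (((Path.Homotopic.Quotient.mk (c x)).trans q).trans (Path.Homotopic.Quotient.mk (c y)).symm))

lemma symm_trans_cancel {w x y : D} (p : Path.Homotopic.Quotient w x)
    (r : Path.Homotopic.Quotient x y) : p.symm.trans (p.trans r) = r := by
  rw [← Path.Homotopic.Quotient.trans_assoc, Path.Homotopic.Quotient.symm_trans,
    Path.Homotopic.Quotient.refl_trans]

lemma Mo_trans {x y z : D} (q : Path.Homotopic.Quotient x y) (r : Path.Homotopic.Quotient y z) :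
    Mo c (q.trans r) = Mo c q * Mo c r := by
  rw [Mo, Mo, Mo, ← MulOpposite.op_mul, FundamentalGroup.mul_def]
  congr 1
  simp [FundamentalGroup.fromPath, FundamentalGroup.fromArrow, symm_trans_cancel]

lemma Mo_refl (x : D) : Mo c (Path.Homotopic.Quotient.refl x) = 1 := by
  rw [Mo, ← MulOpposite.op_one, FundamentalGroup.one_def]
  congr 1
  simp [FundamentalGroup.fromPath, FundamentalGroup.fromArrow]

lemma Mo_eq_one {x : D} (q : Path.Homotopic.Quotient x x) (h : Mo c q = 1) :
    q = Path.Homotopic.Quotient.refl x := by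
  rw [Mo, ← MulOpposite.op_one, FundamentalGroup.one_def] at h
  have h1 := MulOpposite.op_injective h
  simp only [FundamentalGroup.fromPath, FundamentalGroup.fromArrow] at h1
  have h2 := congrArg (fun w => ((Path.Homotopic.Quotient.mk (c x)).symm.trans w).trans
    (Path.Homotopic.Quotient.mk (c x))) h1
  simpa [symm_trans_cancel] using h2

lemma Mo_cast {x y x' y' : D} (q : Path.Homotopic.Quotient x y) (hx : x' = x) (hy : y' = y) :
    Mo c (q.cast hx hy) = Mo c q := by
  subst hx hy
  simp

open Classical in
noncomputable def gD (x y : D) : (FundamentalGroup D b)ᵐᵒᵖ :=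
  if h : ∃ p : Path x y, ∀ t, (p t : ℝ × ℝ) ∈ segment ℝ (x : ℝ × ℝ) y then
    Mo c (Path.Homotopic.Quotient.mk h.choose) else 1

lemma gD_spec {C : Set (ℝ × ℝ)} (hC : Convex ℝ C) (hCD : C ⊆ D) {x y : D} (p : Path x y)
    (hp : ∀ t, (p t : ℝ × ℝ) ∈ C) : gD c x y = Mo c (Path.Homotopic.Quotient.mk p) := by
  have hx : (x : ℝ × ℝ) ∈ C := by simpa using hp 0
  have hy : (y : ℝ × ℝ) ∈ C := by simpa using hp 1
  have hs : segment ℝ (x : ℝ × ℝ) y ⊆ C := hC.segment_subset hx hy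
  have h := exists_path_convex (convex_segment (x : ℝ × ℝ) (y : ℝ × ℝ)) (hs.trans hCD) x y
    (left_mem_segment _ _ _) (right_mem_segment _ _ _)
  rw [gD, dif_pos h]
  congr 1
  exact Path.Homotopic.Quotient.eq.2
    (homot_convex hC hCD _ _ (fun t => hs (h.choose_spec t)) hp)

open Classical in
noncomputable def gg (x y : ℝ × ℝ) : (FundamentalGroup D b)ᵐᵒᵖ :=
  if h : x ∈ D ∧ y ∈ D then gD c ⟨x, h.1⟩ ⟨y, h.2⟩ else 1

lemma gg_eq (x y : D) : gg c (x : ℝ × ℝ) y = gD c x y := by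
  simp [gg]

lemma gg_T {C : Set (ℝ × ℝ)} (hC : Convex ℝ C) (hCD : C ⊆ D) (x : ℝ × ℝ) (hx : x ∈ C)
    (y : ℝ × ℝ) (hy : y ∈ C) (z : ℝ × ℝ) (hz : z ∈ C) :
    gg c x y * gg c y z = gg c x z := by
  lift x to D using hCD hx
  lift y to D using hCD hy
  lift z to D using hCD hz
  obtain ⟨p, hp⟩ := exists_path_convex hC hCD x y hx hy
  obtain ⟨q, hq⟩ := exists_path_convex hC hCD y z hy hz
  have hpq : ∀ t, ((p.trans q) t : ℝ × ℝ) ∈ C := by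
    intro t
    have : (p.trans q) t ∈ range (p.trans q) := mem_range_self t
    rw [Path.trans_range] at this
    rcases this with ⟨s, hs⟩ | ⟨s, hs⟩
    · rw [← hs]; exact hp s
    · rw [← hs]; exact hq s
  rw [gg_eq, gg_eq, gg_eq, gD_spec c hC hCD p hp, gD_spec c hC hCD q hq,
    gD_spec c hC hCD _ hpq, Path.Homotopic.Quotient.mk_trans, Mo_trans]

lemma exists_lower (L : List (ℤ × ℤ)) : ∃ M : ℤ, ∀ u ∈ L, M ≤ u.1 ∧ M ≤ u.2 := by
  induction L with
  | nil => simp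
  | cons b L ih =>
    obtain ⟨N, hN⟩ := ih
    refine ⟨min N (min b.1 b.2), ?_⟩
    intro u hu
    rcases List.mem_cons.1 hu with rfl | hu
    · constructor <;> simp
    · have := hN u hu
      exact ⟨min_le_of_left_le this.1, min_le_of_left_le this.2⟩

lemma box_subset_ball {u v : ℤ × ℤ} {y : ℝ × ℝ} {r : ℝ} (hu : pt u ∈ Metric.ball y r)
    (hv : pt v ∈ Metric.ball y r) : box u v ⊆ Metric.ball y r := by
  obtain ⟨y1, y2⟩ := y
  rw [← ball_prod_same] at *
  rw [Real.ball_eq_Ioo, Real.ball_eq_Ioo] at *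
  exact Set.prod_mono (ordConnected_Ioo.uIcc_subset hu.1 hv.1)
    (ordConnected_Ioo.uIcc_subset hu.2 hv.2)

/-- the lattice point below-left of a point -/
noncomputable def fl (y : ℝ × ℝ) : ℤ × ℤ := (⌊y.1⌋, ⌊y.2⌋)

lemma floor_near {x y : ℝ} (h : |x - y| < 1) : |⌊x⌋ - ⌊y⌋| ≤ 1 := by
  rw [abs_lt] at h
  have a1 := Int.floor_le x
  have a2 := Int.lt_floor_add_one x
  have b1 := Int.floor_le y
  have b2 := Int.lt_floor_add_one y
  have h1 : ⌊x⌋ < ⌊y⌋ + 2 := by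
    have : (⌊x⌋ : ℝ) < ⌊y⌋ + 2 := by linarith
    exact_mod_cast this
  have h2 : ⌊y⌋ < ⌊x⌋ + 2 := by
    have : (⌊y⌋ : ℝ) < ⌊x⌋ + 2 := by linarith
    exact_mod_cast this
  rw [abs_le]; omega

/-- purely combinatorial consequence for chains of nearby points -/
lemma chain_loop {G : Type*} [Group G] {D : Set (ℝ × ℝ)} (hS : Sep D) (g : ℝ × ℝ → ℝ × ℝ → G)
    (hT : ∀ C : Set (ℝ × ℝ), Convex ℝ C → C ⊆ D → ∀ x ∈ C, ∀ y ∈ C, ∀ z ∈ C,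
      g x y * g y z = g x z) (y : ℕ → ℝ × ℝ) (n : ℕ)
    (hball : ∀ k, Metric.ball (y k) 3 ⊆ D) (hy : ∀ k, dist (y k) (y (k + 1)) < 1)
    (hyn : y n = y 0) (F : ℕ → G) (hF0 : F 0 = 1)
    (hF : ∀ k, F (k + 1) = F k * g (y k) (y (k + 1))) : F n = 1 := by
  have mem : ∀ (k : ℕ) (x : ℝ × ℝ), |x.1 - (y k).1| < 3 → |x.2 - (y k).2| < 3 →
      x ∈ Metric.ball (y k) 3 := by
    intro k x h1 h2
    rw [Metric.mem_ball, Prod.dist_eq]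
    exact max_lt (by rwa [Real.dist_eq]) (by rwa [Real.dist_eq])
  have yy : ∀ k, |(y k).1 - (y (k + 1)).1| < 1 ∧ |(y k).2 - (y (k + 1)).2| < 1 := by
    intro k
    have := hy k
    rw [Prod.dist_eq, max_lt_iff, Real.dist_eq, Real.dist_eq] at this
    exact this
  have fb : ∀ x : ℝ, |(⌊x⌋ : ℝ) - x| ≤ 1 := by
    intro x
    rw [abs_le]
    constructor <;> linarith [Int.floor_le x, Int.lt_floor_add_one x]
  have m0 : ∀ k, y k ∈ Metric.ball (y k) 3 := fun k => by simp
  have m1 : ∀ k, pt (fl (y k)) ∈ Metric.ball (y k) 3 := fun k =>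
    mem k _ ((fb _).trans_lt (by norm_num)) ((fb _).trans_lt (by norm_num))
  have tri : ∀ a b c : ℝ, |a - b| ≤ 1 → |c - b| < 1 → |a - c| < 3 := by
    intro a b c h1 h2
    rw [abs_le] at h1
    rw [abs_lt] at h2 ⊢
    constructor <;> linarith
  have m2 : ∀ k, y (k + 1) ∈ Metric.ball (y k) 3 := fun k => by
    rw [Metric.mem_ball, dist_comm]; linarith [hy k]
  have m3 : ∀ k, pt (fl (y (k + 1))) ∈ Metric.ball (y k) 3 := fun k =>
    mem k _ (tri _ _ _ (fb _) (yy k).1) (tri _ _ _ (fb _) (yy k).2)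
  have m4 : ∀ k, pt ((fl (y (k + 1))).1, (fl (y k)).2) ∈ Metric.ball (y k) 3 := fun k =>
    mem k _ (tri _ _ _ (fb _) (yy k).1) ((fb _).trans_lt (by norm_num))
  have T := fun k => hT _ (convex_ball (y k) 3) (hball k)
  have hself : ∀ k, ∀ x ∈ Metric.ball (y k) 3, g x x = 1 := by
    intro k x hx
    simpa using T k x hx x hx x hx
  set e : ℤ × ℤ → ℤ × ℤ → G := fun u v => g (pt u) (pt v) with he
  have claim : ∀ k, ∃ l : List (ℤ × ℤ),
      List.IsChain (R D) (fl (y 0) :: (l ++ [fl (y k)])) ∧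
      F k = g (y 0) (pt (fl (y 0))) * P e (fl (y 0)) (l ++ [fl (y k)]) *
        g (pt (fl (y k))) (y k) := by
    intro k
    induction k with
    | zero =>
      refine ⟨[], ?_, ?_⟩
      · simp only [List.nil_append, List.isChain_cons_cons, List.isChain_singleton, and_true]
        exact ⟨by simp [Adj], (box_subset_ball (m1 0) (m1 0)).trans (hball 0)⟩
      · simp only [List.nil_append, P, mul_one]
        rw [hF0, T 0 _ (m0 0) _ (m1 0) _ (m1 0), T 0 _ (m0 0) _ (m1 0) _ (m0 0), hself 0 _ (m0 0)]
    | succ k ih =>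
      obtain ⟨l, hl, hFk⟩ := ih
      refine ⟨l ++ [fl (y k), ((fl (y (k + 1))).1, (fl (y k)).2)], ?_, ?_⟩
      · have h4 : fl (y 0) :: (l ++ [fl (y k), ((fl (y (k + 1))).1, (fl (y k)).2)] ++
            [fl (y (k + 1))]) = (fl (y 0) :: l) ++ fl (y k) ::
              [((fl (y (k + 1))).1, (fl (y k)).2), fl (y (k + 1))] := by simp
        rw [h4, List.isChain_split]
        refine ⟨by simpa using hl, ?_⟩
        simp only [List.isChain_cons_cons, List.isChain_singleton, and_true]
        refine ⟨⟨?_, (box_subset_ball (m1 k) (m4 k)).trans (hball k)⟩,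
          ⟨?_, (box_subset_ball (m4 k) (m3 k)).trans (hball k)⟩⟩
        · simpa [Adj, fl] using floor_near (yy k).1
        · simpa [Adj, fl] using floor_near (yy k).2
      · have h4 : l ++ [fl (y k), ((fl (y (k + 1))).1, (fl (y k)).2)] ++
            [fl (y (k + 1))] = l ++ fl (y k) ::
              [((fl (y (k + 1))).1, (fl (y k)).2), fl (y (k + 1))] := by simp
        rw [h4, P_append, hF, hFk]
        simp only [P, mul_one, he, mul_assoc]
        congr 2
        rw [T k _ (m1 k) _ (m0 k) _ (m2 k), T k _ (m4 k) _ (m3 k) _ (m2 k),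
          T k _ (m1 k) _ (m4 k) _ (m2 k)]
  obtain ⟨l, hl, hFn⟩ := claim n
  rw [hyn] at hl hFn
  obtain ⟨M, hM⟩ := exists_lower (fl (y 0) :: l)
  have := core hS g hT M _ _ (fl (y 0)) l rfl rfl hM hl
  rw [hFn, this, mul_one, T 0 _ (m0 0) _ (m1 0) _ (m0 0), hself 0 _ (m0 0)]

end Pi1

theorem main (D : Set (ℝ × ℝ)) (hopen : IsOpen D) (hconn : IsConnected D) (hS : Sep D) :
    SimplyConnectedSpace D := by
  have hpc : IsPathConnected D := (hopen.isConnected_iff_isPathConnected).1 hconn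
  rw [simply_connected_iff_loops_nullhomotopic]
  haveI : PathConnectedSpace D := isPathConnected_iff_pathConnectedSpace.1 hpc
  refine ⟨inferInstance, fun b γ => ?_⟩
  let c : ∀ x : D, Path b x := fun x => PathConnectedSpace.somePath b x
  let f : unitInterval → ℝ × ℝ := fun t => (γ t : ℝ × ℝ)
  have hf : Continuous f := continuous_subtype_val.comp γ.continuous
  have hK : IsCompact (range f) := isCompact_range hf
  obtain ⟨ε, hε, hεD⟩ := hK.exists_thickening_subset_open hopen
    (by rintro _ ⟨t, rfl⟩; exact (γ t).2)
  have hballD : ∀ t, Metric.ball (f t) ε ⊆ D := fun t =>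
    (Metric.ball_subset_thickening (mem_range_self t) ε).trans hεD
  set δ : ℝ := ε / 3 with hδ
  have hδ0 : 0 < δ := by positivity
  obtain ⟨η, hη, hfη⟩ := Metric.uniformContinuous_iff.1
    (CompactSpace.uniformContinuous_of_continuous hf) δ hδ0
  obtain ⟨n, hn⟩ := exists_nat_one_div_lt hη
  set N : ℕ := n + 1 with hN
  let τ : ℕ → unitInterval := fun k => projIcc 0 1 zero_le_one ((k : ℝ) / N)
  have hNpos : (0 : ℝ) < N := by rw [hN]; positivity
  have hτmono : ∀ k, τ k ≤ τ (k + 1) := fun k => by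
    apply monotone_projIcc
    gcongr
    simp
  have hττ : ∀ k, dist (τ k) (τ (k + 1)) < η := by
    intro k
    rw [Subtype.dist_eq, Real.dist_eq]
    refine (abs_projIcc_sub_projIcc (zero_le_one)).trans_lt ?_
    have : (k : ℝ) / N - ((k + 1 : ℕ) : ℝ) / N = - (1 / N) := by
      push_cast; field_simp; ring
    rw [this, abs_neg, abs_of_pos (by positivity)]
    rw [hN]; push_cast; exact hn
  have hτ0 : τ 0 = 0 := by
    simp only [τ]
    exact projIcc_of_le_left _ (by simp)
  have hτN : τ N = 1 := by
    simp only [τ]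
    exact projIcc_of_right_le _ (by rw [div_self hNpos.ne'])
  have hsub : ∀ k (s : unitInterval), s ∈ Icc (τ k) (τ (k + 1)) →
      f s ∈ Metric.ball (f (τ k)) ε := by
    intro k s hs
    have h1 : dist s (τ k) < η := by
      refine lt_of_le_of_lt ?_ (hττ k)
      rw [Subtype.dist_eq, Subtype.dist_eq, Real.dist_eq, Real.dist_eq]
      have a1 : (τ k : ℝ) ≤ s := hs.1
      have a2 : (s : ℝ) ≤ τ (k + 1) := hs.2
      rw [abs_of_nonneg (by linarith), abs_sub_comm, abs_of_nonneg (by linarith)]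
      linarith
    have := hfη h1
    rw [Metric.mem_ball]; linarith
  have hsm : ∀ k, δ • (δ⁻¹ • f (τ k)) = f (τ k) := fun k => smul_inv_smul₀ hδ0.ne' _
  have hM0 : ∀ t : unitInterval, t = 0 →
      Mo c (Path.Homotopic.Quotient.mk (γ.subpath 0 t)) = 1 := by
    rintro t rfl
    rw [Path.subpath_self, Path.Homotopic.Quotient.mk_refl]
    exact Mo_refl c _
  have hM1 : ∀ t : unitInterval, t = 1 →
      Mo c (Path.Homotopic.Quotient.mk (γ.subpath 0 t)) =
        Mo c (Path.Homotopic.Quotient.mk γ) := by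
    rintro t rfl
    rw [Path.subpath_zero_one, Path.Homotopic.Quotient.mk_cast, Mo_cast]
  have key := chain_loop (D := {p | δ • p ∈ D}) (sep_smul hS hδ0.ne')
    (fun x y => gg c (δ • x) (δ • y)) (by
      open Pointwise in
      intro C hC hCD x hx y hy z hz
      refine gg_T c (C := δ • C) (hC.smul δ) ?_ _ (smul_mem_smul_set hx) _
        (smul_mem_smul_set hy) _ (smul_mem_smul_set hz)
      rintro _ ⟨w, hw, rfl⟩
      exact hCD hw)
    (fun k => δ⁻¹ • f (τ k)) N (by
      intro k p hp
      apply hballD (τ k)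
      rw [Metric.mem_ball] at hp ⊢
      rw [← hsm k, dist_smul₀, Real.norm_of_nonneg hδ0.le]
      calc δ * dist p (δ⁻¹ • f (τ k)) < δ * 3 := by gcongr
        _ = ε := by rw [hδ]; ring) (by
      intro k
      rw [dist_smul₀, Real.norm_of_nonneg (by positivity), inv_mul_lt_iff₀ hδ0, mul_one]
      exact hfη (hττ k)) (by
      simp only [hτN, hτ0, f, γ.source, γ.target])
    (fun k => Mo c (Path.Homotopic.Quotient.mk (γ.subpath 0 (τ k)))) (hM0 _ hτ0) (by
      intro k
      simp only [hsm]
      have e1 : gg c (f (τ k)) (f (τ (k + 1))) =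
          Mo c (Path.Homotopic.Quotient.mk (γ.subpath (τ k) (τ (k + 1)))) := by
        rw [gg_eq]
        refine gD_spec c (convex_ball (f (τ k)) ε) (hballD _) _ ?_
        intro t
        have h1 : γ.subpath (τ k) (τ (k + 1)) t ∈ range (γ.subpath (τ k) (τ (k + 1))) :=
          mem_range_self t
        rw [Path.range_subpath_of_le _ _ _ (hτmono k)] at h1
        obtain ⟨s, hs, hst⟩ := h1
        rw [← hst]
        exact hsub k s hs
      rw [e1, ← Mo_trans, ← Path.Homotopic.Quotient.mk_trans]
      congr 1
      exact Path.Homotopic.Quotient.eq.2 ⟨(Path.Homotopy.subpathTransSubpath γ _ _ _).symm⟩)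
  have key := (hM1 _ hτN).symm.trans key
  exact Path.Homotopic.Quotient.eq.1 (Mo_eq_one c _ key)

end SC17

/-- An open connected subset of the plane whose complement in the one-point
compactification `S² = ℝ² ∪ {∞}` is connected is simply connected. -/
theorem stmt_17 (D : Set (ℝ × ℝ)) (hne : D.Nonempty) (hopen : IsOpen D)
    (hconn : IsConnected D)
    (hcompl : IsConnected
      (((fun x : ℝ × ℝ => (x : OnePoint (ℝ × ℝ))) '' D)ᶜ)) :
    SimplyConnectedSpace D :=
  SC17.main D hopen hconn (SC17.sep_of_compl hcompl)
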